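/- arXiv:0706.2088 — 2 statements merged into one kernel-verified Lean document; each statement's English description precedes it below -/
import Mathlib

section
/- Let D > 0, v ≠ 0, E∞ < 0, let f : [0,∞) → ℝ be continuous, and let σ₀, ρ₀, E₀ : ℝ → ℝ be differentiable with σ₀ twice differentiable, satisfying for all ξ ∈ ℝ: (i) D σ₀''(ξ) + (v + E₀(ξ)) σ₀'(ξ) + σ₀(ξ)(ρ₀(ξ) − σ₀(ξ)) + σ₀(ξ) f(|E₀(ξ)|) = 0, (ii) v ρ₀'(ξ) + σ₀(ξ) f(|E₀(ξ)|) = 0, (iii) E₀'(ξ) = ρ₀(ξ) − σ₀(ξ). Then the function c(ξ) = D σ₀'(ξ) − v (ρ₀(ξ) − σ₀(ξ)) + E₀(ξ) σ₀(ξ) is constant on ℝ. If, moreover, σ₀(ξ) → 0, σ₀'(ξ) → 0 and ρ₀(ξ) → 0 as ξ → +∞ and E₀ is bounded, then c ≡ 0, i.e. D σ₀' = v(ρ₀ − σ₀) − E₀ σ₀ on all of ℝ. -/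
/-- For a planar front profile `(σ₀, ρ₀, E₀)` solving the second-order traveling wave
equations, the quantity `c(ξ) = D σ₀' - v(ρ₀ - σ₀) + E₀ σ₀` is constant; if moreover
`σ₀, σ₀', ρ₀ → 0` as `ξ → +∞` and `E₀` is bounded, then `c ≡ 0`. -/
theorem stmt2 (D v Einf : ℝ) (hD : 0 < D) (hv : v ≠ 0) (hEinf : Einf < 0)
    (f : ℝ → ℝ) (hf : ContinuousOn f (Set.Ici 0))
    (σ σ' ρ E : ℝ → ℝ)
    (hσ : ∀ ξ : ℝ, HasDerivAt σ (σ' ξ) ξ)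
    (hσ' : ∀ ξ : ℝ, HasDerivAt σ'
      (-((v + E ξ) * σ' ξ + σ ξ * (ρ ξ - σ ξ) + σ ξ * f |E ξ|) / D) ξ)
    (hρ : ∀ ξ : ℝ, HasDerivAt ρ (-(σ ξ * f |E ξ|) / v) ξ)
    (hE : ∀ ξ : ℝ, HasDerivAt E (ρ ξ - σ ξ) ξ) :
    (∀ ξ₁ ξ₂ : ℝ,
      D * σ' ξ₁ - v * (ρ ξ₁ - σ ξ₁) + E ξ₁ * σ ξ₁
        = D * σ' ξ₂ - v * (ρ ξ₂ - σ ξ₂) + E ξ₂ * σ ξ₂) ∧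
    (Filter.Tendsto σ Filter.atTop (nhds 0) →
     Filter.Tendsto σ' Filter.atTop (nhds 0) →
     Filter.Tendsto ρ Filter.atTop (nhds 0) →
     (∃ C : ℝ, ∀ ξ : ℝ, |E ξ| ≤ C) →
     ∀ ξ : ℝ, D * σ' ξ = v * (ρ ξ - σ ξ) - E ξ * σ ξ) := by
  have hc : ∀ ξ : ℝ, HasDerivAt (fun ξ => D * σ' ξ - v * (ρ ξ - σ ξ) + E ξ * σ ξ) 0 ξ := by
    intro ξ
    refine ((((hσ' ξ).const_mul D).sub (((hρ ξ).sub (hσ ξ)).const_mul v)).add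
      ((hE ξ).mul (hσ ξ))).congr_deriv ?_
    field_simp
    ring
  have hconst : ∀ ξ₁ ξ₂ : ℝ,
      D * σ' ξ₁ - v * (ρ ξ₁ - σ ξ₁) + E ξ₁ * σ ξ₁
        = D * σ' ξ₂ - v * (ρ ξ₂ - σ ξ₂) + E ξ₂ * σ ξ₂ :=
    is_const_of_deriv_eq_zero (fun ξ => (hc ξ).differentiableAt) (fun ξ => (hc ξ).deriv)
  refine ⟨hconst, fun hσ0 hσ'0 hρ0 ⟨C, hC⟩ ξ => ?_⟩
  have hEσ : Filter.Tendsto (fun x => E x * σ x) Filter.atTop (nhds 0) := by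
    refine squeeze_zero_norm (a := fun x => C * |σ x|) (fun x => ?_) ?_
    · rw [Real.norm_eq_abs, abs_mul]
      exact mul_le_mul_of_nonneg_right (hC x) (abs_nonneg _)
    · simpa using hσ0.abs.const_mul C
  have hlim : Filter.Tendsto (fun x => D * σ' x - v * (ρ x - σ x) + E x * σ x)
      Filter.atTop (nhds 0) := by
    simpa using ((hσ'0.const_mul D).sub ((hρ0.sub hσ0).const_mul v)).add hEσ
  have hzero : D * σ' ξ - v * (ρ ξ - σ ξ) + E ξ * σ ξ = 0 :=
    tendsto_nhds_unique (tendsto_const_nhds.congr (hconst ξ)) hlim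
  linarith
end

section
/- Let b ≥ 0 and define S : [0, 1/4] → ℝ by S(K) = K(1 − 4K)/(1 + bK). Then S attains its maximum over [0, 1/4] at a unique point K_max, K_max lies in (0, 1/8], and the maximum value S_max = S(K_max) satisfies S_max = 4 K_max² (equivalently K_max² / S_max = 1/4, independently of b). Moreover b = (1 − 8 K_max)/(4 K_max²) and b = (1 − 4√(S_max))/S_max. -/
/-- The critical-point equation `4bm² + 8m = 1` of the fit formula has a positive solution. -/
theorem exists_pos_root_of_fit (b : ℝ) (hb : 0 ≤ b) :
    ∃ m : ℝ, 0 < m ∧ 4*b*m^2 + 8*m = 1 := by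
  have hr : Real.sqrt (4 + b)^2 = 4 + b := Real.sq_sqrt (by linarith)
  have hr0 := Real.sqrt_nonneg (4 + b)
  refine ⟨1 / (2*(2 + Real.sqrt (4 + b))), by positivity, ?_⟩
  field_simp
  linear_combination -4 * hr

/-- Completing the square around a critical point of the fit formula. -/
theorem fit_eq_sub_sq {b m K : ℝ} (hb : 0 ≤ b) (hm : 4*b*m^2 + 8*m = 1) (hK : 0 ≤ K) :
    K*(1 - 4*K) / (1 + b*K) = 4*m^2 - 4*(K - m)^2 / (1 + b*K) := by
  have hbK := mul_nonneg hb hK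
  have hpos : 1 + b*K ≠ 0 := by positivity
  rw [eq_sub_iff_add_eq, ← add_div, div_eq_iff hpos]
  linear_combination -K * hm

/-- The rescaled fit formula `S(K) = K(1 - 4K)/(1 + bK)` on `[0, 1/4]` (with `b ≥ 0`)
attains its maximum at a unique point `K_max ∈ (0, 1/8]`, the maximal value satisfies
`S_max = 4 K_max²` (i.e. `K_max²/S_max = 1/4`, independently of `b`), and moreover
`b = (1 - 8K_max)/(4K_max²) = (1 - 4√S_max)/S_max`. -/
theorem stmt15 (b : ℝ) (hb : 0 ≤ b) :
    let S : ℝ → ℝ := fun K => K * (1 - 4*K) / (1 + b*K)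
    ∃ Kmax ∈ Set.Icc (0:ℝ) (1/4),
      (∀ K ∈ Set.Icc (0:ℝ) (1/4), S K ≤ S Kmax) ∧
      (∀ K' ∈ Set.Icc (0:ℝ) (1/4), (∀ K ∈ Set.Icc (0:ℝ) (1/4), S K ≤ S K') → K' = Kmax) ∧
      Kmax ∈ Set.Ioc (0:ℝ) (1/8) ∧
      S Kmax = 4 * Kmax^2 ∧
      b = (1 - 8*Kmax) / (4*Kmax^2) ∧
      b = (1 - 4*Real.sqrt (S Kmax)) / (S Kmax) := by
  intro S
  obtain ⟨m, hm0, hm⟩ := exists_pos_root_of_fit b hb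
  have hm8 : m ≤ 1/8 := by nlinarith [mul_nonneg hb (sq_nonneg m)]
  have hS : ∀ K, 0 ≤ K → S K = 4*m^2 - 4*(K - m)^2 / (1 + b*K) :=
    fun K hK => fit_eq_sub_sq hb hm hK
  have hSm : S m = 4*m^2 := by simp [hS m hm0.le]
  have hmI : m ∈ Set.Icc (0:ℝ) (1/4) := ⟨hm0.le, by linarith⟩
  have hsqrt : Real.sqrt (4*m^2) = 2*m := by
    rw [show 4*m^2 = (2*m)^2 by ring, Real.sqrt_sq (by linarith)]
  refine ⟨m, hmI, ?_, ?_, ⟨hm0, hm8⟩, hSm, ?_, ?_⟩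
  · intro K hK
    have hbK := mul_nonneg hb hK.1
    have : 0 ≤ 4*(K - m)^2 / (1 + b*K) := by positivity
    rw [hSm, hS K hK.1]
    linarith
  · intro K hK hmax
    have hbK := mul_nonneg hb hK.1
    have hle := hmax m hmI
    rw [hSm, hS K hK.1] at hle
    by_contra hne
    have hsub : K - m ≠ 0 := sub_ne_zero.mpr hne
    have : 0 < 4*(K - m)^2 / (1 + b*K) := by positivity
    linarith
  · rw [eq_div_iff (by positivity)]
    linarith
  · rw [hSm, hsqrt, eq_div_iff (by positivity)]
    linarith
end
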